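/- On the assignment problem with n = 8 agents and 8 items, no mechanism simultaneously satisfies ex-ante favoring-eagerness-for-remaining-items (ea-FERI), strong equal treatment of equals (SETE), and sd-weak-strategyproofness (sd-WSP). -/

import Mathlib

open Finset

noncomputable section

namespace FeriPaper

/-- A preference profile: `R j o o'` means agent `j` strictly prefers item `o` to `o'`. -/
abbrev Pref (n : ℕ) := Fin n → Fin n → Fin n → Prop

/-- Every agent's preference is a strict linear (total) order on the items. -/
def IsProfile {n : ℕ} (R : Pref n) : Prop :=
  ∀ j : Fin n, IsStrictTotalOrder (Fin n) (R j)

/-- Profiles as a type (for mechanisms). -/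
def Profile (n : ℕ) := { R : Pref n // IsProfile R }

/-- `o` is agent `j`'s most preferred item in the set `S`. -/
def IsTopIn {n : ℕ} (R : Pref n) (j : Fin n) (S : Set (Fin n)) (o : Fin n) : Prop :=
  o ∈ S ∧ ∀ o' ∈ S, o' ≠ o → R j o o'

/-- `Tunion R A r` is the union `T_1(A) ∪ ⋯ ∪ T_r(A)` (so `Tunion R A 0 = ∅`). -/
def Tunion {n : ℕ} (R : Pref n) (A : Equiv.Perm (Fin n)) : ℕ → Set (Fin n)
  | 0 => ∅
  | r + 1 =>
      Tunion R A r ∪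
        {o | ∃ j : Fin n, A j ∉ Tunion R A r ∧ IsTopIn R j (Tunion R A r)ᶜ o}

/-- `Tset R A r` is the set `T_{r+1}(A)` (0-based round index). -/
def Tset {n : ℕ} (R : Pref n) (A : Equiv.Perm (Fin n)) (r : ℕ) : Set (Fin n) :=
  {o | ∃ j : Fin n, A j ∉ Tunion R A r ∧ IsTopIn R j (Tunion R A r)ᶜ o}

/-- Favoring-eagerness-for-remaining-items (FERI). -/
def FERI {n : ℕ} (R : Pref n) (A : Equiv.Perm (Fin n)) : Prop :=
  ∀ r : ℕ, ∀ o ∈ Tset R A r, IsTopIn R (A.symm o) (Tunion R A r)ᶜ o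

/-- Pareto efficiency (PE) of a deterministic assignment. -/
def ParetoEff {n : ℕ} (R : Pref n) (A : Equiv.Perm (Fin n)) : Prop :=
  ¬ ∃ (A' : Equiv.Perm (Fin n)) (N' : Set (Fin n)), N'.Nonempty ∧
      (∀ j ∈ N', R j (A' j) (A j)) ∧ ∀ k, k ∉ N' → A' k = A k

/-- Number of agents receiving their overall first choice. -/
def firstChoiceCount {n : ℕ} (R : Pref n) (A : Equiv.Perm (Fin n)) : ℕ :=
  {j : Fin n | IsTopIn R j Set.univ (A j)}.ncard

/-- First-choice maximality (FCM). -/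
def FCM {n : ℕ} (R : Pref n) (A : Equiv.Perm (Fin n)) : Prop :=
  ¬ ∃ A' : Equiv.Perm (Fin n), firstChoiceCount R A < firstChoiceCount R A'

/-- Rank of item `o` in agent `j`'s preference (1 = most preferred). -/
def rank {n : ℕ} (R : Pref n) (j o : Fin n) : ℕ :=
  {o' : Fin n | R j o' o ∨ o' = o}.ncard

/-- Favoring-higher-ranks (FHR). -/
def FHR {n : ℕ} (R : Pref n) (A : Equiv.Perm (Fin n)) : Prop :=
  ∀ j k : Fin n, rank R j (A j) ≤ rank R k (A j) ∨ rank R k (A k) < rank R k (A j)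

/-- Popularity (POP). -/
def POP {n : ℕ} (R : Pref n) (A : Equiv.Perm (Fin n)) : Prop :=
  ¬ ∃ A' : Equiv.Perm (Fin n),
      {j : Fin n | R j (A j) (A' j)}.ncard < {j : Fin n | R j (A' j) (A j)}.ncard

/-- Signature of a deterministic assignment: `signature R A r` is the number of agents
    assigned their `r`-th ranked item. -/
def signature {n : ℕ} (R : Pref n) (A : Equiv.Perm (Fin n)) (r : ℕ) : ℕ :=
  {j : Fin n | rank R j (A j) = r}.ncard

/-- `x` dominates `y` as signatures. -/
def SigDom (x y : ℕ → ℕ) : Prop :=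
  ∃ r : ℕ, y r < x r ∧ ∀ r' < r, y r' ≤ x r'

/-- Rank maximality (RM). -/
def RM {n : ℕ} (R : Pref n) (A : Equiv.Perm (Fin n)) : Prop :=
  ¬ ∃ A' : Equiv.Perm (Fin n), SigDom (signature R A') (signature R A)

/-- A random assignment: a doubly stochastic matrix. -/
def DoublyStochastic {n : ℕ} (P : Fin n → Fin n → ℝ) : Prop :=
  (∀ j o, 0 ≤ P j o) ∧ (∀ j, ∑ o, P j o = 1) ∧ (∀ o, ∑ j, P j o = 1)

/-- The 0-1 permutation matrix of a deterministic assignment. -/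
def permMatrix {n : ℕ} (A : Equiv.Perm (Fin n)) : Fin n → Fin n → ℝ :=
  fun j o => if A j = o then 1 else 0

/-- Upper contour set of item `o` under the strict preference `pr`. -/
def ucs {n : ℕ} (pr : Fin n → Fin n → Prop) (o : Fin n) : Set (Fin n) :=
  {x | pr x o ∨ x = o}

/-- Total probability mass on the upper contour set of `o`. -/
def upperSum {n : ℕ} (pr : Fin n → Fin n → Prop) (p : Fin n → ℝ) (o : Fin n) : ℝ :=
  ∑ x, (ucs pr o).indicator p x

/-- `p` (weakly) stochastically dominates `q` w.r.t. the strict preference `pr`. -/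
def SD {n : ℕ} (pr : Fin n → Fin n → Prop) (p q : Fin n → ℝ) : Prop :=
  ∀ o, upperSum pr q o ≤ upperSum pr p o

/-- sd-envy-freeness. -/
def sdEF {n : ℕ} (R : Pref n) (P : Fin n → Fin n → ℝ) : Prop :=
  ∀ j k : Fin n, SD (R j) (P j) (P k)

/-- sd-weak-envy-freeness. -/
def sdWEF {n : ℕ} (R : Pref n) (P : Fin n → Fin n → ℝ) : Prop :=
  ∀ j k : Fin n, SD (R j) (P k) (P j) → P j = P k

/-- The common prefix of the preferences of agents `j` and `k`: items all of whose
    (weak) upper contour sets w.r.t. `j` coincide for `j` and `k`. -/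
def commonPrefix {n : ℕ} (R : Pref n) (j k : Fin n) : Set (Fin n) :=
  {o | ∀ x ∈ ucs (R j) o, ucs (R j) x = ucs (R k) x}

/-- Strong equal treatment of equals (SETE). -/
def SETE {n : ℕ} (R : Pref n) (P : Fin n → Fin n → ℝ) : Prop :=
  ∀ j k : Fin n, ∀ o ∈ commonPrefix R j k, P j o = P k o

/-- A random assignment satisfies a property `X` ex post if it is a convex combination
    of (permutation matrices of) deterministic assignments each satisfying `X`. -/
def ExPost {n : ℕ} (X : Equiv.Perm (Fin n) → Prop) (P : Fin n → Fin n → ℝ) : Prop :=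
  ∃ w : Equiv.Perm (Fin n) → ℝ, (∀ A, 0 ≤ w A) ∧ (∑ A, w A) = 1 ∧
    (∀ A, w A ≠ 0 → X A) ∧ ∀ j o, P j o = ∑ A, w A * permMatrix A j o

/-- Ex-ante favoring-higher-ranks (ea-FHR). -/
def EaFHR {n : ℕ} (R : Pref n) (P : Fin n → Fin n → ℝ) : Prop :=
  ∀ j o, 0 < P j o → ∀ k, rank R k o < rank R j o → upperSum (R k) (P k) o = 1

/-- The eating structure for ea-FERI: `(eaState R P r).1 = M_{P,r+1}` and
    `(eaState R P r).2 o = ⋃_{r' ≤ r+1} E_{P,r'}(o)` (1-based indexing on the right). -/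
def eaState {n : ℕ} (R : Pref n) (P : Fin n → Fin n → ℝ) :
    ℕ → Set (Fin n) × (Fin n → Set (Fin n))
  | 0 => (Set.univ, fun o => {j | IsTopIn R j Set.univ o})
  | r + 1 =>
      let prev := eaState R P r
      let M : Set (Fin n) := {o | ∑ k, (prev.2 o).indicator (fun k' => P k' o) k < 1}
      (M, fun o => prev.2 o ∪ {j | IsTopIn R j M o})

/-- `eaM R P r = M_{P,r+1}` (0-based round index). -/
def eaM {n : ℕ} (R : Pref n) (P : Fin n → Fin n → ℝ) (r : ℕ) : Set (Fin n) :=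
  (eaState R P r).1

/-- `eaE R P r o = E_{P,r+1}(o)` (0-based round index). -/
def eaE {n : ℕ} (R : Pref n) (P : Fin n → Fin n → ℝ) (r : ℕ) (o : Fin n) : Set (Fin n) :=
  {j | IsTopIn R j (eaM R P r) o}

/-- Ex-ante FERI (ea-FERI). -/
def EaFERI {n : ℕ} (R : Pref n) (P : Fin n → Fin n → ℝ) : Prop :=
  ∀ r : ℕ, ∀ o ∈ eaM R P r, ∀ j : Fin n, (∃ r' < r, j ∈ eaE R P r' o) →
    upperSum (R j) (P j) o = 1

/-- sd-Pareto-efficiency (sd-PE). -/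
def SdPE {n : ℕ} (R : Pref n) (P : Fin n → Fin n → ℝ) : Prop :=
  ¬ ∃ Q : Fin n → Fin n → ℝ, DoublyStochastic Q ∧ Q ≠ P ∧ ∀ j, SD (R j) (Q j) (P j)

/-- `A` is the output of the adaptive Boston mechanism with priority order `prio`
    (`prio j k` means `j` has higher priority than `k`): in every round, every item that
    receives applicants is assigned to its highest-priority applicant. -/
def ABMOutcome {n : ℕ} (prio : Fin n → Fin n → Prop) (R : Pref n)
    (A : Equiv.Perm (Fin n)) : Prop :=
  ∀ r : ℕ, ∀ o ∈ Tset R A r,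
    IsTopIn R (A.symm o) (Tunion R A r)ᶜ o ∧
      ∀ j : Fin n, A j ∉ Tunion R A r → IsTopIn R j (Tunion R A r)ᶜ o →
        j ≠ A.symm o → prio (A.symm o) j

end FeriPaper

namespace FeriPaper

/-- Ranks: `rk true` is the true profile, in `rk false` agent 0 swaps items 2 and 3. -/
def rk (t : Bool) (j o : Fin 8) : ℕ :=
  match j with
  | 0 => if t then ![0, 1, 2, 3, 4, 5, 6, 7] o else ![0, 1, 3, 2, 4, 5, 6, 7] o
  | 6 => ![2, 3, 1, 4, 0, 5, 6, 7] o
  | 7 => ![2, 3, 7, 4, 0, 1, 5, 6] o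
  | _ => ![0, 1, 7, 2, 4, 5, 3, 6] o

lemma rk_inj (t : Bool) (j : Fin 8) : ∀ o o', rk t j o = rk t j o' → o = o' := by
  revert t j; decide

def prof (t : Bool) : Pref 8 := fun j o o' => rk t j o < rk t j o'

lemma prof_isProfile (t : Bool) : IsProfile (prof t) := by
  intro j
  exact { irrefl := fun a => lt_irrefl (rk t j a)
          trans := fun a b c h1 h2 => lt_trans (a := rk t j a) h1 h2
          trichotomous := fun a b h1 h2 => rk_inj t j a b (le_antisymm (not_lt.1 h2) (not_lt.1 h1)) }

/-- Agents whose best item in `S` is `o`. -/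
def topF (t : Bool) (S : Finset (Fin 8)) (o : Fin 8) : Finset (Fin 8) :=
  univ.filter fun j => o ∈ S ∧ ∀ o' ∈ S, o' ≠ o → rk t j o < rk t j o'

lemma top_eq (t : Bool) (S : Finset (Fin 8)) (o : Fin 8) :
    {j | IsTopIn (prof t) j (S : Set (Fin 8)) o} = (topF t S o : Set (Fin 8)) := by
  ext j; simp [IsTopIn, topF, prof]

lemma ind_sum (A : Finset (Fin 8)) (g : Fin 8 → ℝ) :
    ∑ k, ((A : Set (Fin 8)).indicator g k) = ∑ k ∈ A, g k := by
  rw [Finset.sum_indicator_subset g (Finset.subset_univ A)]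

lemma upper_eq (t : Bool) (j : Fin 8) (p : Fin 8 → ℝ) (o : Fin 8) :
    upperSum (prof t j) p o = ∑ x ∈ univ.filter (fun x => rk t j x < rk t j o ∨ x = o), p x := by
  rw [upperSum]
  have : ucs (prof t j) o =
      ((univ.filter (fun x => rk t j x < rk t j o ∨ x = o) : Finset (Fin 8)) : Set (Fin 8)) := by
    ext y; simp [ucs, prof]
  rw [this, ind_sum]

/-- The state is given by explicit finite sets. -/
def IsSt (t : Bool) (P : Fin 8 → Fin 8 → ℝ) (r : ℕ) (S : Finset (Fin 8))
    (C : Fin 8 → Finset (Fin 8)) : Prop :=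
  (eaState (prof t) P r).1 = (S : Set (Fin 8)) ∧
    ∀ o, (eaState (prof t) P r).2 o = (C o : Set (Fin 8))

lemma st_zero (t : Bool) (P : Fin 8 → Fin 8 → ℝ) : IsSt t P 0 univ (topF t univ) := by
  refine ⟨by simp [eaState], fun o => ?_⟩
  rw [← top_eq]; simp [eaState]

lemma st_succ {t : Bool} {P : Fin 8 → Fin 8 → ℝ} {r : ℕ} {S : Finset (Fin 8)}
    {C : Fin 8 → Finset (Fin 8)} (h : IsSt t P r S C) (S' : Finset (Fin 8))
    (hS : ∀ o, (o ∈ S' ↔ ∑ k ∈ C o, P k o < 1)) :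
    IsSt t P (r + 1) S' (fun o => C o ∪ topF t S' o) := by
  have h1 : (eaState (prof t) P (r + 1)).1 = (S' : Set (Fin 8)) := by
    ext o
    show (∑ k, ((eaState (prof t) P r).2 o).indicator (fun k' => P k' o) k < 1) ↔ _
    rw [h.2 o, ind_sum, Finset.mem_coe, hS]
  refine ⟨h1, fun o => ?_⟩
  have : (eaState (prof t) P (r + 1)).2 o = (eaState (prof t) P r).2 o ∪
    {j | IsTopIn (prof t) j (eaState (prof t) P (r + 1)).1 o} := rfl
  rw [this, h1, h.2, top_eq]; simp

/-- If `o` is not exhausted after round `r`, agents who pursue `o` in round `r` are satiated. -/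
lemma sat {t : Bool} {P : Fin 8 → Fin 8 → ℝ} (hF : EaFERI (prof t) P) {r : ℕ}
    {S : Finset (Fin 8)} {C : Fin 8 → Finset (Fin 8)} (h : IsSt t P r S C) (o : Fin 8)
    (hlt : ∑ k ∈ C o, P k o < 1) (j : Fin 8) (hj : j ∈ topF t S o) :
    ∑ x ∈ univ.filter (fun x => rk t j x < rk t j o ∨ x = o), P j x = 1 := by
  rw [← upper_eq]
  refine hF (r + 1) o ?_ j ⟨r, Nat.lt_succ_self r, ?_⟩
  · show (∑ k, ((eaState (prof t) P r).2 o).indicator (fun k' => P k' o) k < 1)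
    rwa [h.2 o, ind_sum]
  · show j ∈ {j | IsTopIn (prof t) j (eaState (prof t) P r).1 o}
    rw [h.1, top_eq]; exact hj

lemma sete {t : Bool} {P : Fin 8 → Fin 8 → ℝ} (hE : SETE (prof t) P) (j k o : Fin 8)
    (h : ∀ x, (rk t j x < rk t j o ∨ x = o) →
      ∀ y, (rk t j y < rk t j x ∨ y = x) ↔ (rk t k y < rk t k x ∨ y = x)) :
    P j o = P k o := by
  refine hE j k o fun x hx => ?_
  ext y; exact h x hx y


def S1 : Finset (Fin 8) := {1, 2, 3, 5, 6, 7}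
def S2 : Finset (Fin 8) := {2, 3, 5, 6, 7}
def S3 : Finset (Fin 8) := {2, 5, 6, 7}
def C0 (t : Bool) : Fin 8 → Finset (Fin 8) := topF t univ
def C1 (t : Bool) : Fin 8 → Finset (Fin 8) := fun o => C0 t o ∪ topF t S1 o
def C2 (t : Bool) : Fin 8 → Finset (Fin 8) := fun o => C1 t o ∪ topF t S2 o
def C3 (t : Bool) : Fin 8 → Finset (Fin 8) := fun o => C2 t o ∪ topF t S3 o

lemma round0 {t : Bool} {P : Fin 8 → Fin 8 → ℝ} (hD : DoublyStochastic P)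
    (hF : EaFERI (prof t) P) (hE : SETE (prof t) P) :
    IsSt t P 1 S1 (C1 t) ∧ (∀ j : Fin 8, j < 6 → P j 0 = 1 / 6) ∧ P 6 4 = 1 / 2 ∧ P 7 4 = 1 / 2 := by
  have h0 := st_zero t P
  have e0 : C0 t 0 = {0, 1, 2, 3, 4, 5} := by cases t <;> decide
  have e4 : C0 t 4 = {6, 7} := by cases t <;> decide
  have a0 : ∑ k ∈ C0 t 0, P k 0 = 1 := by
    refine le_antisymm ?_ ?_
    · rw [← hD.2.2 0]
      exact Finset.sum_le_sum_of_subset_of_nonneg (subset_univ _) fun i _ _ => hD.1 i 0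
    · by_contra! hlt
      have := sat hF h0 0 hlt 1 (by cases t <;> decide)
      rw [show (univ.filter (fun x => rk t 1 x < rk t 1 0 ∨ x = 0)) = {0} by cases t <;> decide,
        sum_singleton] at this
      rw [e0] at hlt
      have := Finset.single_le_sum (f := fun k => P k 0) (s := {0, 1, 2, 3, 4, 5})
        (fun i _ => hD.1 i 0) (show (1 : Fin 8) ∈ _ by decide)
      linarith
  have a4 : ∑ k ∈ C0 t 4, P k 4 = 1 := by
    refine le_antisymm ?_ ?_
    · rw [← hD.2.2 4]
      exact Finset.sum_le_sum_of_subset_of_nonneg (subset_univ _) fun i _ _ => hD.1 i 4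
    · by_contra! hlt
      have := sat hF h0 4 hlt 6 (by cases t <;> decide)
      rw [show (univ.filter (fun x => rk t 6 x < rk t 6 4 ∨ x = 4)) = {4} by cases t <;> decide,
        sum_singleton] at this
      rw [e4] at hlt
      have := Finset.single_le_sum (f := fun k => P k 4) (s := {6, 7})
        (fun i _ => hD.1 i 4) (show (6 : Fin 8) ∈ _ by decide)
      linarith
  refine ⟨st_succ h0 S1 ?_, ?_, ?_⟩
  · intro o
    change _ ↔ ∑ k ∈ C0 t o, P k o < 1
    by_cases ho0 : o = 0
    · subst ho0; rw [a0]; simp [S1]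
    by_cases ho4 : o = 4
    · subst ho4; rw [a4]; simp [S1]
    have : C0 t o = ∅ ∧ o ∈ S1 := by revert o; cases t <;> decide
    simp [this.1, this.2]
  · have hs : ∀ j : Fin 8, j < 6 → P j 0 = P 0 0 := fun j hj =>
      sete hE j 0 0 (by revert j; cases t <;> decide)
    rw [e0, Finset.sum_congr rfl (g := fun _ => P 0 0) (fun j hj => hs j (by revert j; decide))] at a0
    simp at a0
    intro j hj
    rw [hs j hj]; linarith
  · have hs := sete hE 6 7 4 (by cases t <;> decide)
    rw [e4] at a4
    simp at a4
    constructor <;> linarith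

lemma round1 {t : Bool} {P : Fin 8 → Fin 8 → ℝ} (hD : DoublyStochastic P)
    (hF : EaFERI (prof t) P) (hE : SETE (prof t) P) :
    IsSt t P 2 S2 (C2 t) ∧ (∀ j : Fin 8, j < 6 → P j 1 = 1 / 6) ∧ P 6 2 = 1 / 2 := by
  obtain ⟨h1, q0, q6, q7⟩ := round0 hD hF hE
  have e0 : C1 t 0 = {0, 1, 2, 3, 4, 5} := by cases t <;> decide
  have e4 : C1 t 4 = {6, 7} := by cases t <;> decide
  have e1 : C1 t 1 = {0, 1, 2, 3, 4, 5} := by cases t <;> decide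
  have e2 : C1 t 2 = {6} := by cases t <;> decide
  have e5 : C1 t 5 = {7} := by cases t <;> decide
  have hs : ∀ j : Fin 8, j < 6 → P j 1 = P 0 1 := fun j hj =>
      sete hE j 0 1 (by revert j; cases t <;> decide)
  have b1 : ∑ k ∈ C1 t 1, P k 1 = 6 * P 0 1 := by
    rw [e1, Finset.sum_congr rfl (g := fun _ => P 0 1) (fun j hj => hs j (by revert j; decide))]
    simp
  have a1 : ∑ k ∈ C1 t 1, P k 1 = 1 := by
    refine le_antisymm ?_ ?_
    · rw [← hD.2.2 1]
      exact Finset.sum_le_sum_of_subset_of_nonneg (subset_univ _) fun i _ _ => hD.1 i 1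
    · by_contra! hlt
      have := sat hF h1 1 hlt 0 (by cases t <;> decide)
      rw [show (univ.filter (fun x => rk t 0 x < rk t 0 1 ∨ x = 1)) = {0, 1} by cases t <;> decide,
        sum_pair (by decide)] at this
      have := q0 0 (by decide)
      linarith
  have r6 : P 6 4 + P 6 2 ≤ 1 := by
    rw [← hD.2.1 6, ← Finset.sum_pair (f := fun o => P 6 o) (show (4 : Fin 8) ≠ 2 by decide)]
    exact Finset.sum_le_sum_of_subset_of_nonneg (subset_univ _) fun i _ _ => hD.1 6 i
  have r7 : P 7 4 + P 7 5 ≤ 1 := by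
    rw [← hD.2.1 7, ← Finset.sum_pair (f := fun o => P 7 o) (show (4 : Fin 8) ≠ 5 by decide)]
    exact Finset.sum_le_sum_of_subset_of_nonneg (subset_univ _) fun i _ _ => hD.1 7 i
  have l2 : ∑ k ∈ C1 t 2, P k 2 < 1 := by rw [e2, sum_singleton]; linarith
  refine ⟨st_succ h1 S2 ?_, ?_, ?_⟩
  · intro o
    change _ ↔ ∑ k ∈ C1 t o, P k o < 1
    by_cases ho0 : o = 0
    · subst ho0
      rw [e0, Finset.sum_congr rfl (g := fun _ => 1 / 6) (fun j hj => q0 j (by revert j; decide))]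
      simp [S2]
    by_cases ho4 : o = 4
    · subst ho4; rw [e4, sum_pair (by decide), q6, q7]; exact iff_of_false (by decide) (by norm_num)
    by_cases ho1 : o = 1
    · subst ho1; rw [a1]; simp [S2]
    by_cases ho2 : o = 2
    · subst ho2; exact iff_of_true (by decide) l2
    by_cases ho5 : o = 5
    · subst ho5; rw [e5, sum_singleton]; exact iff_of_true (by decide) (by linarith)
    have : C1 t o = ∅ ∧ o ∈ S2 := by revert o; cases t <;> decide
    simp [this.1, this.2]
  · intro j hj
    rw [hs j hj]; linarith
  · have := sat hF h1 2 l2 6 (by cases t <;> decide)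
    rw [show (univ.filter (fun x => rk t 6 x < rk t 6 2 ∨ x = 2)) = {4, 2} by cases t <;> decide,
        sum_pair (by decide)] at this
    linarith

/-- Truthful outcome of agent 0. -/
lemma truth {P : Fin 8 → Fin 8 → ℝ} (hD : DoublyStochastic P)
    (hF : EaFERI (prof true) P) (hE : SETE (prof true) P) : P 0 2 = 1 / 2 ∧ P 0 3 = 0 := by
  obtain ⟨-, q0, q6, q7⟩ := round0 hD hF hE
  obtain ⟨h2, p0, p6⟩ := round1 hD hF hE
  have e2 : C2 true 2 = {0, 6} := by decide
  have e3 : C2 true 3 = {1, 2, 3, 4, 5} := by decide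
  have u2 : ∑ k ∈ C2 true 2, P k 2 ≤ 1 := by
    rw [← hD.2.2 2]
    exact Finset.sum_le_sum_of_subset_of_nonneg (subset_univ _) fun i _ _ => hD.1 i 2
  have z0 := q0 0 (by decide)
  have z1 := p0 0 (by decide)
  constructor
  · by_cases hlt : ∑ k ∈ C2 true 2, P k 2 < 1
    · have := sat hF h2 2 hlt 0 (by decide)
      rw [show (univ.filter (fun x => rk true 0 x < rk true 0 2 ∨ x = 2)) = {0, 1, 2} by decide] at this
      rw [e2, sum_pair (by decide)] at u2
      simp at this
      linarith
    · have := le_antisymm u2 (not_lt.1 hlt)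
      rw [e2, sum_pair (by decide)] at this
      linarith
  · have hs : ∀ j : Fin 8, j ∈ ({1, 2, 3, 4, 5} : Finset (Fin 8)) → P j 3 = P 1 3 := fun j hj =>
      sete hE j 1 3 (by revert j; decide)
    have b3 : ∑ k ∈ C2 true 3, P k 3 = 5 * P 1 3 := by
      rw [e3, Finset.sum_congr rfl (g := fun _ => P 1 3) hs]; simp
    have g3 : 1 ≤ ∑ k ∈ C2 true 3, P k 3 := by
      by_contra! hlt
      have := sat hF h2 3 hlt 1 (by decide)
      rw [show (univ.filter (fun x => rk true 1 x < rk true 1 3 ∨ x = 3)) = {0, 1, 3} by decide] at this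
      simp at this
      have := q0 1 (by decide)
      have := p0 1 (by decide)
      linarith
    have := hD.2.2 3
    rw [e3] at g3
    have hsub : ∑ k ∈ ({0, 1, 2, 3, 4, 5} : Finset (Fin 8)), P k 3 ≤ 1 := by
      rw [← hD.2.2 3]
      exact Finset.sum_le_sum_of_subset_of_nonneg (subset_univ _) fun i _ _ => hD.1 i 3
    rw [Finset.sum_insert (by decide)] at hsub
    exact le_antisymm (by linarith) (hD.1 0 3)

/-- Outcome of agent 0 after the manipulation. -/
lemma manip {P : Fin 8 → Fin 8 → ℝ} (hD : DoublyStochastic P)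
    (hF : EaFERI (prof false) P) (hE : SETE (prof false) P) : P 0 2 = 1 / 2 ∧ P 0 3 = 1 / 6 := by
  obtain ⟨-, q0, q6, q7⟩ := round0 hD hF hE
  obtain ⟨h2, p0, p6⟩ := round1 hD hF hE
  have z0 := q0 0 (by decide)
  have z1 := p0 0 (by decide)
  have e0 : C2 false 0 = {0, 1, 2, 3, 4, 5} := by decide
  have e1 : C2 false 1 = {0, 1, 2, 3, 4, 5} := by decide
  have e3 : C2 false 3 = {0, 1, 2, 3, 4, 5} := by decide
  have e4 : C2 false 4 = {6, 7} := by decide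
  have e2 : C2 false 2 = {6} := by decide
  have e5 : C2 false 5 = {7} := by decide
  have r7 : P 7 4 + P 7 5 ≤ 1 := by
    rw [← hD.2.1 7, ← Finset.sum_pair (f := fun o => P 7 o) (show (4 : Fin 8) ≠ 5 by decide)]
    exact Finset.sum_le_sum_of_subset_of_nonneg (subset_univ _) fun i _ _ => hD.1 7 i
  have hs : ∀ j : Fin 8, j ∈ ({0, 1, 2, 3, 4, 5} : Finset (Fin 8)) → P j 3 = P 0 3 := fun j hj =>
    sete hE j 0 3 (by revert j; decide)
  have b3 : ∑ k ∈ C2 false 3, P k 3 = 6 * P 0 3 := by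
    rw [e3, Finset.sum_congr rfl (g := fun _ => P 0 3) hs]; simp
  have a3 : ∑ k ∈ C2 false 3, P k 3 = 1 := by
    refine le_antisymm ?_ ?_
    · rw [← hD.2.2 3]
      exact Finset.sum_le_sum_of_subset_of_nonneg (subset_univ _) fun i _ _ => hD.1 i 3
    · by_contra! hlt
      have := sat hF h2 3 hlt 0 (by decide)
      rw [show (univ.filter (fun x => rk false 0 x < rk false 0 3 ∨ x = 3)) = {0, 1, 3} by decide] at this
      simp at this
      linarith
  have h3 : IsSt false P 3 S3 (C3 false) := by
    refine st_succ h2 S3 ?_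
    intro o
    by_cases ho0 : o = 0
    · subst ho0
      rw [e0, Finset.sum_congr rfl (g := fun _ => 1 / 6) (fun j hj => q0 j (by revert j; decide))]
      simp [S3]
    by_cases ho4 : o = 4
    · subst ho4; rw [e4, sum_pair (by decide), q6, q7]; exact iff_of_false (by decide) (by norm_num)
    by_cases ho1 : o = 1
    · subst ho1
      rw [e1, Finset.sum_congr rfl (g := fun _ => 1 / 6) (fun j hj => p0 j (by revert j; decide))]
      simp [S3]
    by_cases ho3 : o = 3
    · subst ho3; rw [a3]; simp [S3]
    by_cases ho2 : o = 2
    · subst ho2; rw [e2, sum_singleton]; exact iff_of_true (by decide) (by linarith)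
    by_cases ho5 : o = 5
    · subst ho5; rw [e5, sum_singleton]; exact iff_of_true (by decide) (by linarith)
    have : C2 false o = ∅ ∧ o ∈ S3 := by revert o; decide
    simp [this.1, this.2]
  have f2 : C3 false 2 = {0, 6} := by decide
  have u2 : ∑ k ∈ C3 false 2, P k 2 ≤ 1 := by
    rw [← hD.2.2 2]
    exact Finset.sum_le_sum_of_subset_of_nonneg (subset_univ _) fun i _ _ => hD.1 i 2
  refine ⟨?_, by linarith⟩
  by_cases hlt : ∑ k ∈ C3 false 2, P k 2 < 1
  · have := sat hF h3 2 hlt 0 (by decide)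
    rw [show (univ.filter (fun x => rk false 0 x < rk false 0 2 ∨ x = 2)) = {0, 1, 2, 3} by decide] at this
    simp at this
    linarith
  · have := le_antisymm u2 (not_lt.1 hlt)
    rw [f2, sum_pair (by decide)] at this
    linarith

end FeriPaper


namespace FeriPaper
/-- On the 8-agent, 8-item assignment problem, no mechanism satisfies
ea-FERI, SETE and sd-weak-strategyproofness simultaneously. -/
theorem no_eaFERI_SETE_sdWSP :
    ¬ ∃ f : Profile 8 → (Fin 8 → Fin 8 → ℝ),
        (∀ R, DoublyStochastic (f R)) ∧
        (∀ R, EaFERI R.1 (f R)) ∧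
        (∀ R, SETE R.1 (f R)) ∧
        (∀ (R R' : Profile 8) (j : Fin 8),
          (∀ k, k ≠ j → R'.1 k = R.1 k) →
            SD (R.1 j) (f R' j) (f R j) → f R' j = f R j) := by

  rintro ⟨f, hD, hF, hE, hSP⟩
  let R : Profile 8 := ⟨prof true, prof_isProfile true⟩
  let R' : Profile 8 := ⟨prof false, prof_isProfile false⟩
  obtain ⟨t2, t3⟩ := truth (hD R) (hF R) (hE R)
  obtain ⟨m2, m3⟩ := manip (hD R') (hF R') (hE R')
  have t0 := (round0 (hD R) (hF R) (hE R)).2.1 0 (by decide)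
  have t1 := (round1 (hD R) (hF R) (hE R)).2.1 0 (by decide)
  have m0 := (round0 (hD R') (hF R') (hE R')).2.1 0 (by decide)
  have m1 := (round1 (hD R') (hF R') (hE R')).2.1 0 (by decide)
  have key : f R' 0 = f R 0 := by
    refine hSP R R' 0 ?_ ?_
    · intro k hk
      have : ∀ o, rk false k o = rk true k o := by revert k; decide
      funext o o'
      simp [R, R', prof, this]
    · intro o
      change upperSum (prof true 0) _ o ≤ upperSum (prof true 0) _ o
      rw [upper_eq, upper_eq]
      by_cases ho0 : o = 0
      · subst ho0
        rw [show (univ.filter (fun x => rk true 0 x < rk true 0 0 ∨ x = 0)) = {0} by decide]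
        simp [t0, m0]
      by_cases ho1 : o = 1
      · subst ho1
        rw [show (univ.filter (fun x => rk true 0 x < rk true 0 1 ∨ x = 1)) = {0, 1} by decide]
        simp [t0, m0, t1, m1]
      by_cases ho2 : o = 2
      · subst ho2
        rw [show (univ.filter (fun x => rk true 0 x < rk true 0 2 ∨ x = 2)) = {0, 1, 2} by decide]
        simp [t0, m0, t1, m1, t2, m2]
      have hsub : ({0, 1, 2, 3} : Finset (Fin 8)) ⊆
          univ.filter (fun x => rk true 0 x < rk true 0 o ∨ x = o) := by revert o; decide
      have h1 := Finset.sum_le_sum_of_subset_of_nonneg (f := f R' 0) hsub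
        fun i _ _ => (hD R').1 0 i
      have h2 : ∑ x ∈ univ.filter (fun x => rk true 0 x < rk true 0 o ∨ x = o), f R 0 x ≤ 1 := by
        rw [← (hD R).2.1 0]
        exact Finset.sum_le_sum_of_subset_of_nonneg (subset_univ _) fun i _ _ => (hD R).1 0 i
      have h3 : ∑ x ∈ ({0, 1, 2, 3} : Finset (Fin 8)), f R' 0 x = 1 := by
        simp [m0, m1, m2, m3]; norm_num
      linarith
  rw [key, t3] at m3
  norm_num at m3

end FeriPaper
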